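/- Let W be a finite set of Wang tiles. If the tiling formula ψ_W is not derivable in the Hilbert system TWJ⁺, then W tiles the k-octant 𝕆(k) for every k ∈ ℕ (and hence W tiles ℤ²). -/

import Mathlib

/-- Formulas of the language 𝓛: propositional letters (indexed by ℕ) with ∧, ∨, →. -/
inductive Fml : Type
  | atom : ℕ → Fml
  | and : Fml → Fml → Fml
  | or : Fml → Fml → Fml
  | imp : Fml → Fml → Fml
deriving DecidableEq

/-- A Wang tile: a quadruple `(t_W, t_E, t_N, t_S)` of natural numbers. -/
abbrev Tile : Type := ℕ × ℕ × ℕ × ℕ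

/-- West colour. -/
def tW (t : Tile) : ℕ := t.1
/-- East colour. -/
def tE (t : Tile) : ℕ := t.2.1
/-- North colour. -/
def tN (t : Tile) : ℕ := t.2.2.1
/-- South colour. -/
def tS (t : Tile) : ℕ := t.2.2.2

/-- `W` tiles `D ⊆ ℤ²`: there is a map assigning to each point of `D` a tile of `W`
such that horizontally and vertically adjacent tiles within `D` match. -/
def Tiles (W : Finset Tile) (D : Set (ℤ × ℤ)) : Prop :=
  ∃ τ : ℤ × ℤ → Tile,
    (∀ p ∈ D, τ p ∈ W) ∧
    (∀ m n : ℤ, (m, n) ∈ D → (m + 1, n) ∈ D → tE (τ (m, n)) = tW (τ (m + 1, n))) ∧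
    (∀ m n : ℤ, (m, n) ∈ D → (m, n + 1) ∈ D → tN (τ (m, n)) = tS (τ (m, n + 1)))

/-- The `k`-quadrant `ℚ(k) = {(m,n) : 0 ≤ m,n ≤ k}`. -/
def Quadrant (k : ℕ) : Set (ℤ × ℤ) :=
  {p | 0 ≤ p.1 ∧ p.1 ≤ (k : ℤ) ∧ 0 ≤ p.2 ∧ p.2 ≤ (k : ℤ)}

/-- The `k`-octant `𝕆(k) = {(m,n) : 0 ≤ m ≤ n ≤ k}`. -/
def Octant (k : ℕ) : Set (ℤ × ℤ) :=
  {p | 0 ≤ p.1 ∧ p.1 ≤ p.2 ∧ p.2 ≤ (k : ℤ)}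

/-- The propositional letters used in the tiling formulas: one letter `𝚝` for each
tile `t`, letters `𝚖_{i,j}` for `i,j ∈ {0,1}` (here indexed by `Bool`, `false = 0`,
`true = 1`), and letters `𝚡`, `𝚢`, `𝚙⊤`. -/
inductive Letter : Type
  | tile : Tile → Letter
  | m : Bool → Bool → Letter
  | x : Letter
  | y : Letter
  | pTop : Letter
deriving DecidableEq

/-- Disjunction of a list of formulas (a given default for the empty list). -/
def bigOr (dflt : Fml) : List Fml → Fml
  | [] => dflt
  | f :: fs => fs.foldl .or f

/-- Conjunction of a list of formulas (a given default for the empty list). -/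
def bigAnd (dflt : Fml) : List Fml → Fml
  | [] => dflt
  | f :: fs => fs.foldl .and f

/-- Product of two lists. -/
def listProd {α β : Type*} (l₁ : List α) (l₂ : List β) : List (α × β) :=
  l₁.foldr (fun a acc => (l₂.map fun b => (a, b)) ++ acc) []

/-- The four pairs `(i,j)` with `i,j ∈ {0,1}`. -/
def boolPairs : List (Bool × Bool) :=
  [(false, false), (false, true), (true, false), (true, true)]

variable (enc : Letter → ℕ)

/-- The atom `𝚝` for a tile `t`. -/
def tAt (t : Tile) : Fml := .atom (enc (.tile t))
/-- The atom `𝚖_{i,j}`. -/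
def mAt (i j : Bool) : Fml := .atom (enc (.m i j))
/-- The atom `𝚡`. -/
def xAt : Fml := .atom (enc .x)
/-- The atom `𝚢`. -/
def yAt : Fml := .atom (enc .y)
/-- The atom `𝚙⊤`. -/
def pAt : Fml := .atom (enc .pTop)

/-- The surrogate used for an empty disjunction: `𝚖_{0,0} ∧ 𝚖_{0,1}`. -/
def emptyOr : Fml := .and (mAt enc false false) (mAt enc false true)

/-- The surrogate used for an empty conjunction: `𝚙⊤ → 𝚙⊤`. -/
def emptyAnd : Fml := .imp (pAt enc) (pAt enc)

/-- `R(t) = ⋁{𝚝' : t' ∈ W, t_E = t'_W}`: the permissible rightwards neighbours. -/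
noncomputable def Rt (W : Finset Tile) (t : Tile) : Fml :=
  bigOr (emptyOr enc) (((W.filter fun t' => tE t = tW t').toList).map (tAt enc))

/-- `U(t) = ⋁{𝚝' : t' ∈ W, t_N = t'_S}`: the permissible upwards neighbours. -/
noncomputable def Ut (W : Finset Tile) (t : Tile) : Fml :=
  bigOr (emptyOr enc) (((W.filter fun t' => tN t = tS t').toList).map (tAt enc))

/-- The grid formula `G_{i,j}`. -/
noncomputable def Gf (W : Finset Tile) (i j : Bool) : Fml :=
  .and (mAt enc i j)
    (bigOr (emptyOr enc)
      ((W.toList).map fun t =>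
        .and (tAt enc t)
          (.imp (yAt enc)
            (.or (mAt enc i j) (.and (mAt enc i (!j)) (Ut enc W t))))))

/-- The formula `x'`. -/
noncomputable def xPrime (W : Finset Tile) : Fml :=
  .and (xAt enc) <| .and (pAt enc) <| .and (.imp (pAt enc) (pAt enc)) <|
    .and (bigAnd (emptyAnd enc)
        ((listProd (W.toList) boolPairs).map fun q =>
          .imp (.and (mAt enc q.2.1 q.2.2) (tAt enc q.1))
            (.or (mAt enc q.2.1 q.2.2) (.and (mAt enc (!q.2.1) q.2.2) (Rt enc W q.1))))) <|
      .and (bigAnd (emptyAnd enc)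
          ((listProd boolPairs boolPairs).filterMap fun q =>
            if q.1 ≠ q.2 then
              some (.imp (.and (mAt enc q.1.1 q.1.2) (mAt enc q.2.1 q.2.2))
                (.and (mAt enc false false) (mAt enc false true)))
            else none))
        (bigAnd (emptyAnd enc)
          ((listProd (W.toList) (W.toList)).filterMap fun q =>
            if q.1 ≠ q.2 then
              some (.imp (.and (tAt enc q.1) (tAt enc q.2))
                (.and (mAt enc false false) (mAt enc false true)))
            else none))

/-- The formula `y' = 𝚢 ∧ 𝚙⊤ ∧ (𝚙⊤ → 𝚙⊤)`. -/
def yPrime : Fml := .and (yAt enc) (.and (pAt enc) (.imp (pAt enc) (pAt enc)))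

/-- The notational complement `m^c_{i,j} = 𝚖_{i,1−j} ∨ 𝚖_{1−i,j} ∨ 𝚖_{1−i,1−j}`. -/
def mc (i j : Bool) : Fml :=
  .or (mAt enc i (!j)) (.or (mAt enc (!i) j) (mAt enc (!i) (!j)))

/-- The formula `α = ⋀_{i,j} (m^c_{i,j} → m^c_{i,j})`. -/
def alphaF : Fml :=
  bigAnd (emptyAnd enc) (boolPairs.map fun q => .imp (mc enc q.1 q.2) (mc enc q.1 q.2))

/-- The formula `β₁ = ⋀_{i} ((y' → m^c_{i,i}) → m^c_{i,1−i})`. -/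
def beta1F : Fml :=
  .and (.imp (.imp (yPrime enc) (mc enc false false)) (mc enc false true))
    (.imp (.imp (yPrime enc) (mc enc true true)) (mc enc true false))

/-- The formula `β₂ = ⋀_{i} ((x' → m^c_{1−i,i}) → m^c_{i,i})`. -/
noncomputable def beta2F (W : Finset Tile) : Fml :=
  .and (.imp (.imp (xPrime enc W) (mc enc true false)) (mc enc false false))
    (.imp (.imp (xPrime enc W) (mc enc false true)) (mc enc true true))

/-- The formula `γ = 𝚙⊤ → ⋁_{i,j} G_{i,j}`. -/
noncomputable def gammaF (W : Finset Tile) : Fml :=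
  .imp (pAt enc) (bigOr (emptyOr enc) (boolPairs.map fun q => Gf enc W q.1 q.2))

/-- The tiling formula `ψ_W = (α ∧ β₁ ∧ β₂ ∧ γ ∧ G_{0,0}) → (x' → m^c_{1,0})`. -/
noncomputable def psiW (W : Finset Tile) : Fml :=
  .imp
    (.and (alphaF enc) (.and (beta1F enc) (.and (beta2F enc W)
      (.and (gammaF enc W) (Gf enc W false false)))))
    (.imp (xPrime enc W) (mc enc true false))

/-- Derivability in the Hilbert system TWJ⁺. -/
inductive TWJ : Fml → Prop
  | id (φ : Fml) : TWJ (.imp φ φ)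
  | andE1 (φ ψ : Fml) : TWJ (.imp (.and φ ψ) φ)
  | andE2 (φ ψ : Fml) : TWJ (.imp (.and φ ψ) ψ)
  | andI (φ ψ χ : Fml) :
      TWJ (.imp (.and (.imp φ ψ) (.imp φ χ)) (.imp φ (.and ψ χ)))
  | orI1 (φ ψ : Fml) : TWJ (.imp φ (.or φ ψ))
  | orI2 (φ ψ : Fml) : TWJ (.imp ψ (.or φ ψ))
  | orE (φ ψ χ : Fml) :
      TWJ (.imp (.and (.imp φ χ) (.imp ψ χ)) (.imp (.or φ ψ) χ))
  | distrib (φ ψ χ : Fml) :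
      TWJ (.imp (.and φ (.or ψ χ)) (.or (.and φ ψ) (.and φ χ)))
  | hypSyll (φ ψ χ : Fml) :
      TWJ (.imp (.and (.imp φ ψ) (.imp ψ χ)) (.imp φ χ))
  | prefixing (φ ψ χ : Fml) :
      TWJ (.imp (.imp φ ψ) (.imp (.imp χ φ) (.imp χ ψ)))
  | suffixing (φ ψ χ : Fml) :
      TWJ (.imp (.imp φ ψ) (.imp (.imp ψ χ) (.imp φ χ)))
  | mp {φ ψ : Fml} : TWJ φ → TWJ (.imp φ ψ) → TWJ ψ
  | adj {φ ψ : Fml} : TWJ φ → TWJ ψ → TWJ (.and φ ψ)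

namespace TWJP

lemma tr {φ ψ χ : Fml} (h1 : TWJ (.imp φ ψ)) (h2 : TWJ (.imp ψ χ)) : TWJ (.imp φ χ) :=
  .mp h2 (.mp h1 (.suffixing φ ψ χ))
lemma conj {φ ψ χ : Fml} (h1 : TWJ (.imp φ ψ)) (h2 : TWJ (.imp φ χ)) :
    TWJ (.imp φ (.and ψ χ)) := .mp (.adj h1 h2) (.andI φ ψ χ)
lemma disj {φ ψ χ : Fml} (h1 : TWJ (.imp φ χ)) (h2 : TWJ (.imp ψ χ)) :
    TWJ (.imp (.or φ ψ) χ) := .mp (.adj h1 h2) (.orE φ ψ χ)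
lemma suf {φ ψ : Fml} (χ : Fml) (h : TWJ (.imp φ ψ)) : TWJ (.imp (.imp ψ χ) (.imp φ χ)) :=
  .mp h (.suffixing φ ψ χ)
lemma pre {φ ψ : Fml} (χ : Fml) (h : TWJ (.imp φ ψ)) : TWJ (.imp (.imp χ φ) (.imp χ ψ)) :=
  .mp h (.prefixing φ ψ χ)

/-- Theories: closed under conjunction and provable implication. -/
structure Th (S : Set Fml) : Prop where
  up : ∀ {φ ψ}, TWJ (.imp φ ψ) → φ ∈ S → ψ ∈ S
  ad : ∀ {φ ψ}, φ ∈ S → ψ ∈ S → Fml.and φ ψ ∈ S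

/-- Prime theories. -/
structure PT where
  S : Set Fml
  th : Th S
  prime : ∀ {φ ψ}, Fml.or φ ψ ∈ S → φ ∈ S ∨ ψ ∈ S

/-- Prime extension lemma. -/
lemma extend (T D : Set Fml) (hT : Th T)
    (hor : ∀ {φ ψ}, φ ∈ D → ψ ∈ D → Fml.or φ ψ ∈ D)
    (hdis : ∀ φ ∈ T, φ ∉ D) : ∃ P : PT, T ⊆ P.S ∧ ∀ φ ∈ P.S, φ ∉ D := by
  obtain ⟨M, hTM, hM⟩ := zorn_subset_nonempty {S : Set Fml | Th S ∧ ∀ φ ∈ S, φ ∉ D} (by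
    intro c hc hch hne
    refine ⟨⋃₀ c, ⟨⟨?_, ?_⟩, ?_⟩, fun s hs => Set.subset_sUnion_of_mem hs⟩
    · rintro φ ψ h ⟨s, hs, hφ⟩
      exact ⟨s, hs, (hc hs).1.up h hφ⟩
    · rintro φ ψ ⟨s, hs, hφ⟩ ⟨t, ht, hψ⟩
      rcases hch.total hs ht with h | h
      · exact ⟨t, ht, (hc ht).1.ad (h hφ) hψ⟩
      · exact ⟨s, hs, (hc hs).1.ad hφ (h hψ)⟩
    · rintro φ ⟨s, hs, hφ⟩
      exact (hc hs).2 φ hφ) T ⟨hT, hdis⟩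
  have hMth := hM.prop.1
  have key : ∀ θ φ, θ ∈ M → φ ∉ M → ∃ θ' ∈ M, ∃ δ ∈ D, TWJ (.imp (.and θ' φ) δ) := by
    intro θ φ hθ hφ
    by_contra hcon
    push Not at hcon
    have hmem : {χ | ∃ θ' ∈ M, TWJ (.imp (.and θ' φ) χ)} ∈
        {S : Set Fml | Th S ∧ ∀ φ ∈ S, φ ∉ D} := by
      refine ⟨⟨?_, ?_⟩, ?_⟩
      · rintro χ χ' h ⟨θ', h1, h2⟩
        exact ⟨θ', h1, tr h2 h⟩
      · rintro χ χ' ⟨θ1, h1, h2⟩ ⟨θ2, h3, h4⟩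
        refine ⟨.and θ1 θ2, hMth.ad h1 h3, conj (tr (conj ?_ ?_) h2) (tr (conj ?_ ?_) h4)⟩
        · exact tr (.andE1 _ _) (.andE1 _ _)
        · exact .andE2 _ _
        · exact tr (.andE1 _ _) (.andE2 _ _)
        · exact .andE2 _ _
      · rintro χ ⟨θ', h1, h2⟩ hD
        exact hcon θ' h1 χ hD h2
    have hsub := hM.le_of_ge hmem (fun χ hχ => ⟨χ, hχ, .andE1 _ _⟩)
    exact hφ (hsub ⟨θ, hθ, .andE2 _ _⟩)
  refine ⟨⟨M, hMth, ?_⟩, hTM, hM.prop.2⟩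
  intro φ ψ h
  by_contra hcon
  push Not at hcon
  obtain ⟨θ1, h1, δ1, hd1, hp1⟩ := key _ φ h hcon.1
  obtain ⟨θ2, h2, δ2, hd2, hp2⟩ := key _ ψ h hcon.2
  refine hM.prop.2 (.or δ1 δ2) ?_ (hor hd1 hd2)
  refine hMth.up ?_ (hMth.ad (hMth.ad h1 h2) h)
  refine tr (.distrib _ _ _) (disj (tr (tr (conj ?_ ?_) hp1) (.orI1 _ _))
    (tr (tr (conj ?_ ?_) hp2) (.orI2 _ _)))
  · exact tr (.andE1 _ _) (.andE1 _ _)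
  · exact .andE2 _ _
  · exact tr (.andE1 _ _) (.andE2 _ _)
  · exact .andE2 _ _

/-- The canonical ternary relation. -/
def R (a b c : PT) : Prop := ∀ φ ψ, Fml.imp φ ψ ∈ a.S → φ ∈ b.S → ψ ∈ c.S

/-- Fusion of theories. -/
def fus (A B : Set Fml) : Set Fml := {ψ | ∃ φ, Fml.imp φ ψ ∈ A ∧ φ ∈ B}

lemma fus_th {A B : Set Fml} (hA : Th A) (hB : Th B) : Th (fus A B) := by
  constructor
  · rintro φ ψ h ⟨χ, h1, h2⟩
    exact ⟨χ, hA.up (pre _ h) h1, h2⟩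
  · rintro φ ψ ⟨χ, h1, h2⟩ ⟨χ', h3, h4⟩
    refine ⟨.and χ χ', hA.up (.andI _ _ _) (hA.ad ?_ ?_), hB.ad h2 h4⟩
    · exact hA.up (suf _ (.andE1 _ _)) h1
    · exact hA.up (suf _ (.andE2 _ _)) h3

lemma ext2 (a c : PT) (B : Set Fml) (hB : Th B)
    (h : ∀ φ ψ, Fml.imp φ ψ ∈ a.S → φ ∈ B → ψ ∈ c.S) :
    ∃ b : PT, B ⊆ b.S ∧ R a b c := by
  have hor : ∀ {φ ψ}, φ ∈ {φ | ∃ ψ, ψ ∉ c.S ∧ Fml.imp φ ψ ∈ a.S} →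
      ψ ∈ {φ | ∃ ψ, ψ ∉ c.S ∧ Fml.imp φ ψ ∈ a.S} →
      Fml.or φ ψ ∈ {φ | ∃ ψ, ψ ∉ c.S ∧ Fml.imp φ ψ ∈ a.S} := by
    rintro φ ψ ⟨χ, h1, h2⟩ ⟨χ', h3, h4⟩
    refine ⟨.or χ χ', fun hc => (c.prime hc).elim h1 h3, a.th.up (.orE _ _ _) (a.th.ad ?_ ?_)⟩
    · exact a.th.up (pre _ (.orI1 _ _)) h2
    · exact a.th.up (pre _ (.orI2 _ _)) h4
  obtain ⟨P, h1, h2⟩ := extend B {φ | ∃ ψ, ψ ∉ c.S ∧ Fml.imp φ ψ ∈ a.S} hB hor (by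
    rintro φ hφ ⟨ψ, h1, h2⟩
    exact h1 (h _ _ h2 hφ))
  refine ⟨P, h1, fun φ ψ hi hφ => ?_⟩
  by_contra hc
  exact h2 φ hφ ⟨ψ, hc, hi⟩

lemma frameB {a b c d x : PT} (h1 : R a b x) (h2 : R x c d) : ∃ y, R b c y ∧ R a y d := by
  obtain ⟨y, h3, h4⟩ := ext2 a d (fus b.S c.S) (fus_th b.th c.th) (by
    rintro χ ψ h ⟨φ, h5, h6⟩
    exact h2 _ _ (h1 _ _ (a.th.up (.prefixing _ _ _) h) h5) h6)
  exact ⟨y, fun φ ψ hi hφ => h3 ⟨φ, hi, hφ⟩, h4⟩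

lemma frameB' {a b c d x : PT} (h1 : R a b x) (h2 : R x c d) : ∃ y, R a c y ∧ R b y d := by
  obtain ⟨y, h3, h4⟩ := ext2 b d (fus a.S c.S) (fus_th a.th c.th) (by
    rintro χ ψ h ⟨φ, h5, h6⟩
    exact h2 _ _ (h1 _ _ (a.th.up (.suffixing _ _ _) h5) h) h6)
  exact ⟨y, fun φ ψ hi hφ => h3 ⟨φ, hi, hφ⟩, h4⟩

lemma frameJ {a b c : PT} (h1 : R a b c) : ∃ y, R a b y ∧ R a y c := by
  obtain ⟨y, h3, h4⟩ := ext2 a c (fus a.S b.S) (fus_th a.th b.th) (by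
    rintro χ ψ h ⟨φ, h5, h6⟩
    exact h1 _ _ (a.th.up (.hypSyll _ _ _) (a.th.ad h5 h)) h6)
  exact ⟨y, fun φ ψ hi hφ => h3 ⟨φ, hi, hφ⟩, h4⟩

lemma princ_th (φ : Fml) : Th {χ | TWJ (.imp φ χ)} :=
  ⟨fun h h' => tr h' h, fun h h' => conj h h'⟩

lemma avoid (T : Set Fml) (hT : Th T) (ψ : Fml) (h : ψ ∉ T) : ∃ P : PT, T ⊆ P.S ∧ ψ ∉ P.S := by
  obtain ⟨P, h1, h2⟩ := extend T {φ | TWJ (.imp φ ψ)} hT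
    (fun h h' => disj h h') (fun φ hφ hd => h (hT.up hd hφ))
  exact ⟨P, h1, fun hc => h2 ψ hc (.id ψ)⟩

lemma not_imp {a : PT} {φ ψ : Fml} (h : Fml.imp φ ψ ∉ a.S) :
    ∃ b c, R a b c ∧ φ ∈ b.S ∧ ψ ∉ c.S := by
  obtain ⟨c, h1, h2⟩ := avoid (fus a.S {χ | TWJ (.imp φ χ)}) (fus_th a.th (princ_th φ)) ψ (by
    rintro ⟨χ, h1, h2⟩
    exact h (a.th.up (suf _ h2) h1))
  obtain ⟨b, h3, h4⟩ := ext2 a c {χ | TWJ (.imp φ χ)} (princ_th φ)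
    (fun χ ψ h5 h6 => h1 ⟨χ, h5, h6⟩)
  exact ⟨b, c, h4, h3 (.id φ), h2⟩

lemma and1 {a : PT} {φ ψ : Fml} (h : Fml.and φ ψ ∈ a.S) : φ ∈ a.S := a.th.up (.andE1 _ _) h
lemma and2 {a : PT} {φ ψ : Fml} (h : Fml.and φ ψ ∈ a.S) : ψ ∈ a.S := a.th.up (.andE2 _ _) h

lemma foldl_or {q : PT} : ∀ (l : List Fml) (f : Fml), l.foldl .or f ∈ q.S →
    f ∈ q.S ∨ ∃ g ∈ l, g ∈ q.S
  | [], f, h => .inl h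
  | g :: l, f, h => by
    rcases foldl_or l (.or f g) h with h | ⟨k, hk, h⟩
    · rcases q.prime h with h | h
      · exact .inl h
      · exact .inr ⟨g, by simp, h⟩
    · exact .inr ⟨k, by simp [hk], h⟩

lemma bigOr_mem {q : PT} {d : Fml} {l : List Fml} (h : bigOr d l ∈ q.S) :
    (l = [] ∧ d ∈ q.S) ∨ ∃ g ∈ l, g ∈ q.S := by
  cases l with
  | nil => exact .inl ⟨rfl, h⟩
  | cons f l =>
    rcases foldl_or l f h with h | ⟨k, hk, h⟩
    · exact .inr ⟨f, by simp, h⟩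
    · exact .inr ⟨k, by simp [hk], h⟩

lemma foldl_and {q : PT} : ∀ (l : List Fml) (f : Fml), l.foldl .and f ∈ q.S →
    f ∈ q.S ∧ ∀ g ∈ l, g ∈ q.S
  | [], f, h => ⟨h, by simp⟩
  | g :: l, f, h => by
    obtain ⟨h1, h2⟩ := foldl_and l (.and f g) h
    refine ⟨and1 h1, ?_⟩
    intro k hk
    rcases List.mem_cons.1 hk with rfl | hk
    · exact and2 h1
    · exact h2 k hk

lemma bigAnd_mem {q : PT} {d : Fml} {l : List Fml} (h : bigAnd d l ∈ q.S) :
    ∀ g ∈ l, g ∈ q.S := by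
  cases l with
  | nil => simp
  | cons f l =>
    obtain ⟨h1, h2⟩ := foldl_and l f h
    intro k hk
    rcases List.mem_cons.1 hk with rfl | hk
    · exact h1
    · exact h2 k hk

lemma mem_listProd {α β : Type*} {l₁ : List α} {l₂ : List β} {a : α} {b : β}
    (ha : a ∈ l₁) (hb : b ∈ l₂) : (a, b) ∈ listProd l₁ l₂ := by
  induction l₁ with
  | nil => simp at ha
  | cons c l ih =>
    simp only [listProd, List.foldr_cons, List.mem_append, List.mem_map]
    rcases List.mem_cons.1 ha with rfl | ha
    · exact .inl ⟨b, hb, rfl⟩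
    · exact .inr (ih ha)

lemma mem_boolPairs (s : Bool × Bool) : s ∈ boolPairs := by
  rcases s with ⟨_ | _, _ | _⟩ <;> simp [boolPairs]

/-- Only the marker `s` may hold at `q`. -/
def Good (q : PT) (s : Bool × Bool) : Prop := ∀ i j, mAt enc i j ∈ q.S → (i, j) = s

lemma good_of_mc {q : PT} {i j : Bool} (h : mc enc i j ∉ q.S) : Good enc q (i, j) := by
  intro i' j' hm
  by_contra hne
  apply h
  have e1 : mAt enc i (!j) ∈ q.S → mc enc i j ∈ q.S := q.th.up (.orI1 _ _)
  have e2 : mAt enc (!i) j ∈ q.S → mc enc i j ∈ q.S :=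
    q.th.up (tr (.orI1 _ _) (.orI2 _ _))
  have e3 : mAt enc (!i) (!j) ∈ q.S → mc enc i j ∈ q.S :=
    q.th.up (tr (.orI2 _ _) (.orI2 _ _))
  revert e1 e2 e3 hm hne
  cases i <;> cases j <;> cases i' <;> cases j' <;> simp <;> tauto

lemma xP_right {W : Finset Tile} {x : PT} (h : xPrime enc W ∈ x.S) {t : Tile} (ht : t ∈ W)
    (i j : Bool) : Fml.imp (.and (mAt enc i j) (tAt enc t))
      (.or (mAt enc i j) (.and (mAt enc (!i) j) (Rt enc W t))) ∈ x.S := by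
  refine bigAnd_mem (and1 (and2 (and2 (and2 h)))) _ ?_
  exact List.mem_map.2 ⟨(t, (i, j)), mem_listProd (by simpa using ht) (mem_boolPairs _), rfl⟩

lemma xP_m {W : Finset Tile} {x : PT} (h : xPrime enc W ∈ x.S) {s s' : Bool × Bool}
    (hs : s ≠ s') : Fml.imp (.and (mAt enc s.1 s.2) (mAt enc s'.1 s'.2))
      (.and (mAt enc false false) (mAt enc false true)) ∈ x.S := by
  refine bigAnd_mem (and1 (and2 (and2 (and2 (and2 h))))) _ ?_
  exact List.mem_filterMap.2 ⟨(s, s'), mem_listProd (mem_boolPairs _) (mem_boolPairs _),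
    by simp [hs]⟩

lemma xP_t {W : Finset Tile} {x : PT} (h : xPrime enc W ∈ x.S) {s s' : Tile}
    (h1 : s ∈ W) (h2 : s' ∈ W) (hs : s ≠ s') : Fml.imp (.and (tAt enc s) (tAt enc s'))
      (.and (mAt enc false false) (mAt enc false true)) ∈ x.S := by
  refine bigAnd_mem (and2 (and2 (and2 (and2 (and2 h))))) _ ?_
  exact List.mem_filterMap.2 ⟨(s, s'), mem_listProd (by simpa using h1) (by simpa using h2),
    by simp [hs]⟩

lemma good_no {q : PT} {s} (h : Good enc q s) : emptyOr enc ∉ q.S := by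
  intro hc
  have h1 := h _ _ (and1 hc)
  have h2 := h _ _ (and2 hc)
  rw [← h2] at h1
  simp at h1

/-- Right moves. -/
def H (W : Finset Tile) (q l : PT) : Prop := ∃ x : PT, xPrime enc W ∈ x.S ∧ R x q l
/-- Up moves. -/
def V (q l : PT) : Prop := ∃ y : PT, yPrime enc ∈ y.S ∧ R q y l

lemma uniq_m {W : Finset Tile} {h l : PT} {s} (hH : H enc W h l) (hl : Good enc l s)
    {i j i' j'} (h1 : mAt enc i j ∈ h.S) (h2 : mAt enc i' j' ∈ h.S) : (i, j) = (i', j') := by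
  by_contra hne
  obtain ⟨x, hx, hR⟩ := hH
  exact good_no enc hl (hR _ _ (xP_m enc hx hne) (h.th.ad h1 h2))

lemma uniq_t {W : Finset Tile} {h l : PT} {s} (hH : H enc W h l) (hl : Good enc l s)
    {t t'} (ht : t ∈ W) (ht' : t' ∈ W) (h1 : tAt enc t ∈ h.S) (h2 : tAt enc t' ∈ h.S) :
    t = t' := by
  by_contra hne
  obtain ⟨x, hx, hR⟩ := hH
  exact good_no enc hl (hR _ _ (xP_t enc hx ht ht' hne) (h.th.ad h1 h2))

lemma square {W : Finset Tile} {f k l : PT} (h1 : H enc W f k) (h2 : V enc k l) :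
    ∃ h, V enc f h ∧ H enc W h l := by
  obtain ⟨x, hx, hR⟩ := h1
  obtain ⟨y, hy, hR'⟩ := h2
  obtain ⟨h, h3, h4⟩ := frameB hR hR'
  exact ⟨h, ⟨y, hy, h3⟩, ⟨x, hx, h4⟩⟩

/-- Generated points. -/
def Gen (a q : PT) : Prop := q = a ∨ ∃ w : PT, R a w q ∧ pAt enc ∈ w.S ∧
  Fml.imp (pAt enc) (pAt enc) ∈ w.S

lemma gen_step {a q z h : PT} (hq : Gen enc a q) (hR : R q z h) (h1 : pAt enc ∈ z.S)
    (h2 : Fml.imp (pAt enc) (pAt enc) ∈ z.S) : Gen enc a h := by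
  rcases hq with rfl | ⟨w, h3, h4, h5⟩
  · exact .inr ⟨z, hR, h1, h2⟩
  · obtain ⟨y, h6, h7⟩ := frameB h3 hR
    exact .inr ⟨y, h7, h6 _ _ h5 h1, h6 _ _ (w.th.up (.prefixing _ _ _) h5) h2⟩

lemma gen_V {a q h : PT} (hq : Gen enc a q) (hV : V enc q h) : Gen enc a h := by
  obtain ⟨y, hy, hR⟩ := hV
  exact gen_step enc hq hR (and1 (and2 hy)) (and2 (and2 hy))

lemma gen_x {W : Finset Tile} {a q x h : PT} (hq : Gen enc a q) (hx : xPrime enc W ∈ x.S)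
    (hR : R q x h) : Gen enc a h :=
  gen_step enc hq hR (and1 (and2 hx)) (and1 (and2 (and2 hx)))

lemma gen_G {W : Finset Tile} {a : PT} (hγ : gammaF enc W ∈ a.S)
    (hG : Gf enc W false false ∈ a.S) {q : PT} (hq : Gen enc a q) : ∃ i j, Gf enc W i j ∈ q.S := by
  rcases hq with rfl | ⟨w, h1, h2, h3⟩
  · exact ⟨_, _, hG⟩
  · rcases bigOr_mem (h1 _ _ hγ h2) with ⟨h, _⟩ | ⟨g, hg, h⟩
    · simp [boolPairs] at h
    · obtain ⟨s, _, rfl⟩ := List.mem_map.1 hg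
      exact ⟨_, _, h⟩

lemma G_tile {W : Finset Tile} {q : PT} {i j} (h : Gf enc W i j ∈ q.S) (hW : W.Nonempty) :
    ∃ t ∈ W, tAt enc t ∈ q.S ∧ Fml.imp (yAt enc)
      (.or (mAt enc i j) (.and (mAt enc i (!j)) (Ut enc W t))) ∈ q.S := by
  rcases bigOr_mem (and2 h) with ⟨h, _⟩ | ⟨g, hg, h⟩
  · simp at h
    exact absurd h hW.ne_empty
  · obtain ⟨t, ht, rfl⟩ := List.mem_map.1 hg
    exact ⟨t, by simpa using ht, and1 h, and2 h⟩

lemma G_nonempty {W : Finset Tile} {q : PT} {i j} (h : Gf enc W i j ∈ q.S) {s} (hg : Good enc q s) :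
    W.Nonempty := by
  rcases bigOr_mem (and2 h) with ⟨_, h⟩ | ⟨g, hg, h⟩
  · exact absurd h (good_no enc hg)
  · obtain ⟨t, ht, rfl⟩ := List.mem_map.1 hg
    exact ⟨t, by simpa using ht⟩

lemma good_G {W : Finset Tile} {a : PT} (hγ : gammaF enc W ∈ a.S)
    (hG : Gf enc W false false ∈ a.S) {q : PT} (hq : Gen enc a q) {i j} (hg : Good enc q (i, j)) :
    Gf enc W i j ∈ q.S := by
  obtain ⟨i', j', h⟩ := gen_G enc hγ hG hq
  have := hg _ _ (and1 h)
  simp only [Prod.mk.injEq] at this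
  rwa [this.1, this.2] at h

lemma fill {W : Finset Tile} {a : PT} (hγ : gammaF enc W ∈ a.S)
    (hG : Gf enc W false false ∈ a.S) {f h l : PT} {i j} (hf : Gf enc W i j ∈ f.S) (hfg : Gen enc a f) (hV : V enc f h)
    (hH : H enc W h l) (hl : Good enc l (!i, !j)) : Good enc h (i, !j) := by
  have hh := gen_V enc hfg hV
  obtain ⟨i0, j0, h0⟩ := gen_G enc hγ hG hh
  have hg0 : Good enc h (i0, j0) := fun _ _ h' => uniq_m enc hH hl h' (and1 h0)
  have hW := G_nonempty enc h0 hg0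
  obtain ⟨t0, ht0, htm, _⟩ := G_tile enc h0 hW
  obtain ⟨t, ht, _, hy⟩ := G_tile enc hf hW
  obtain ⟨x, hx, hR⟩ := hH
  have hj : j0 = !j := by
    rcases l.prime (hR _ _ (xP_right enc hx ht0 i0 j0) (h.th.ad (and1 h0) htm)) with h' | h'
    · have := hl _ _ h'
      simp at this; exact this.2
    · have := hl _ _ (and1 h')
      simp at this; exact this.2
  obtain ⟨y, hy', hR'⟩ := hV
  rcases h.prime (hR' _ _ hy (and1 hy')) with h' | h'
  · have := hg0 _ _ h'
    simp [hj] at this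
  · have := hg0 _ _ (and1 h')
    rwa [this]

lemma tile_exists {W : Finset Tile} {a : PT} (hγ : gammaF enc W ∈ a.S)
    (hG : Gf enc W false false ∈ a.S) {q : PT} (hq : Gen enc a q) {i j} (hg : Good enc q (i, j)) :
    ∃ t ∈ W, tAt enc t ∈ q.S ∧ Fml.imp (yAt enc)
      (.or (mAt enc i j) (.and (mAt enc i (!j)) (Ut enc W t))) ∈ q.S := by
  have h := good_G enc hγ hG hq hg
  exact G_tile enc h (G_nonempty enc h hg)

lemma right_match {W : Finset Tile} {q l r : PT} {i j s} (hm : mAt enc i j ∈ q.S) (hl : Good enc l (!i, j))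
    (hH : H enc W q l) (hH' : H enc W l r) (hr : Good enc r s)
    {t t'} (ht : t ∈ W) (ht' : t' ∈ W) (h1 : tAt enc t ∈ q.S) (h2 : tAt enc t' ∈ l.S) :
    tE t = tW t' := by
  obtain ⟨x, hx, hR⟩ := hH
  rcases l.prime (hR _ _ (xP_right enc hx ht i j) (q.th.ad hm h1)) with h' | h'
  · have := hl _ _ h'
    simp at this
  · rcases bigOr_mem (and2 h') with ⟨_, h⟩ | ⟨g, hg, h⟩
    · exact absurd h (good_no enc hl)
    · obtain ⟨t2, ht2, rfl⟩ := List.mem_map.1 hg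
      simp at ht2
      rw [ht2.2, uniq_t enc hH' hr ht2.1 ht' h h2]

lemma up_match {W : Finset Tile} {q l r : PT} {i j s} (hl : Good enc l (i, !j))
    (hV : V enc q l) (hH' : H enc W l r) (hr : Good enc r s)
    {t t'} (ht' : t' ∈ W) (h1 : Fml.imp (yAt enc)
      (.or (mAt enc i j) (.and (mAt enc i (!j)) (Ut enc W t))) ∈ q.S) (h2 : tAt enc t' ∈ l.S) :
    tN t = tS t' := by
  obtain ⟨y, hy, hR⟩ := hV
  rcases l.prime (hR _ _ h1 (and1 hy)) with h' | h'
  · have := hl _ _ h'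
    simp at this
  · rcases bigOr_mem (and2 h') with ⟨_, h⟩ | ⟨g, hg, h⟩
    · exact absurd h (good_no enc hl)
    · obtain ⟨t2, ht2, rfl⟩ := List.mem_map.1 hg
      simp at ht2
      rw [ht2.2, uniq_t enc hH' hr ht2.1 ht' h h2]

/-- Sliding a row upwards. -/
lemma slide {W : Finset Tile} {a : PT} (hγ : gammaF enc W ∈ a.S)
    (hG : Gf enc W false false ∈ a.S) (b : Bool) (q : ℕ → PT) : ∀ n r, (∀ m < n, H enc W (q m) (q (m + 1))) →
    (∀ m ≤ n, Gen enc a (q m) ∧ Gf enc W m.bodd b ∈ (q m).S) → V enc (q n) r →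
    Good enc r (n.bodd, !b) →
    ∃ r' : ℕ → PT, r' n = r ∧ (∀ m ≤ n, V enc (q m) (r' m) ∧ Good enc (r' m) (m.bodd, !b)) ∧
      ∀ m < n, H enc W (r' m) (r' (m + 1)) := by
  intro n
  induction n with
  | zero =>
    intro r _ _ hV hg
    refine ⟨fun _ => r, rfl, ?_, by simp⟩
    intro m hm
    obtain rfl : m = 0 := by omega
    exact ⟨hV, hg⟩
  | succ n ih =>
    intro r hH hq hV hg
    obtain ⟨h, h1, h2⟩ := square enc (hH n (by omega)) hV
    have hgood : Good enc h (n.bodd, !b) := by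
      refine fill enc hγ hG (hq n (by omega)).2 (hq n (by omega)).1 h1 h2 ?_
      simpa [Nat.bodd_succ] using hg
    obtain ⟨r', e, h3, h4⟩ := ih h (fun m hm => hH m (by omega)) (fun m hm => hq m (by omega))
      h1 hgood
    refine ⟨fun m => if m = n + 1 then r else r' m, by simp, ?_, ?_⟩
    · intro m hm
      by_cases hmn : m = n + 1
      · subst hmn; simpa only [if_true] using ⟨hV, hg⟩
      · simpa [hmn] using h3 m (by omega)
    · intro m hm
      by_cases hmn : m = n
      · subst hmn; simpa [e] using h2
      · simpa [hmn, show m ≠ n + 1 by omega] using h4 m (by omega)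

/-- Depth predicate. -/
def Dp (a : PT) (F : Fml) : ℕ → PT → Prop
  | 0, q => F ∉ q.S
  | n + 1, q => ∃ q', R a q q' ∧ Dp a F n q'

lemma dp_not {a : PT} {F : Fml} (h : Fml.imp F F ∈ a.S) : ∀ n q, Dp a F n q → F ∉ q.S
  | 0, _, hq => hq
  | n + 1, _, ⟨q', h1, h2⟩ => fun hc => dp_not h n q' h2 (h1 _ _ h hc)

lemma dp_step {a : PT} {Z F F' : Fml} (hF : Fml.imp F F ∈ a.S)
    (h : Fml.imp (.imp Z F') F ∈ a.S) :
    ∀ n q, Dp a F (n + 1) q → ∃ z q2, Z ∈ z.S ∧ R q z q2 ∧ Dp a F' n q2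
  | 0, q, ⟨q', h1, h2⟩ => by
    have : Fml.imp Z F' ∉ q.S := fun hc => h2 (h1 _ _ h hc)
    obtain ⟨z, q2, h3, h4, h5⟩ := not_imp this
    exact ⟨z, q2, h4, h3, h5⟩
  | n + 1, q, ⟨q', h1, h2⟩ => by
    obtain ⟨z, q2, h3, h4, h5⟩ := dp_step hF h n q' h2
    obtain ⟨y, h6, h7⟩ := frameB h1 h4
    exact ⟨z, y, h3, h6, q2, h7, h5⟩

lemma dp_init {a x c : PT} {F : Fml} (hR : R a x c) (hF : F ∉ c.S) :
    ∀ n, ∃ d, R a x d ∧ Dp a F n d := by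
  have : ∀ n c, R a x c → F ∉ c.S → ∀ k, Dp a F k c → ∃ d, R a x d ∧ Dp a F (k + n) d := by
    intro n
    induction n with
    | zero => intro c h _ k hk; exact ⟨c, h, hk⟩
    | succ n ih =>
      intro c h hc k hk
      obtain ⟨d, h1, h2⟩ := ih c h hc k hk
      obtain ⟨y, h3, h4⟩ := frameJ h1
      exact ⟨y, h3, d, h4, h2⟩
  intro n
  obtain ⟨d, h1, h2⟩ := this n c hR hF 0 hF
  exact ⟨d, h1, by simpa using h2⟩

/-- Row invariant. -/
structure Inv (W : Finset Tile) (a : PT) (n M : ℕ) (q : ℕ → PT) : Prop where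
  hH : ∀ m < n, H enc W (q m) (q (m + 1))
  gen : ∀ m ≤ n, Gen enc a (q m) ∧ Gf enc W m.bodd n.bodd ∈ (q m).S
  good : n ≠ 0 → ∀ m ≤ n, Good enc (q m) (m.bodd, n.bodd)
  next : ∃ x d, R (q n) x d ∧ xPrime enc W ∈ x.S ∧ Dp a (mc enc (!n.bodd) n.bodd) M d

lemma inv_step {W : Finset Tile} {a : PT} (hγ : gammaF enc W ∈ a.S)
    (hG : Gf enc W false false ∈ a.S) (hα : alphaF enc ∈ a.S) (hβ1 : beta1F enc ∈ a.S)
    (hβ2 : beta2F enc W ∈ a.S) {n M q} (hI : Inv enc W a n (M + 2) q) :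
    ∃ q', Inv enc W a (n + 1) M q' ∧ ∀ m ≤ n, V enc (q m) (q' m) := by
  have ha : ∀ i j, Fml.imp (mc enc i j) (mc enc i j) ∈ a.S := fun i j =>
    bigAnd_mem hα _ (List.mem_map.2 ⟨(i, j), mem_boolPairs _, rfl⟩)
  have hb1 : ∀ b, Fml.imp (.imp (yPrime enc) (mc enc (!b) (!b))) (mc enc (!b) b) ∈ a.S := by
    intro b; cases b
    · exact and2 hβ1
    · exact and1 hβ1
  have hb2 : ∀ b, Fml.imp (.imp (xPrime enc W) (mc enc (!b) b)) (mc enc b b) ∈ a.S := by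
    intro b; cases b
    · exact and1 hβ2
    · exact and2 hβ2
  obtain ⟨x, d, hR, hx, hd⟩ := hI.next
  obtain ⟨y, e, hy, hR2, he⟩ := dp_step (ha _ _) (hb1 _) _ _ hd
  obtain ⟨x2, d2, hx2, hR3, hd2⟩ := dp_step (ha _ _) (hb2 _) _ _ he
  obtain ⟨f, h1, h2⟩ := frameB' hR hR2
  have hVf : V enc (q n) f := ⟨y, hy, h1⟩
  have hHf : H enc W f e := ⟨x, hx, h2⟩
  have hge := good_of_mc enc (dp_not (ha _ _) _ _ he)
  have hgf := fill enc hγ hG (hI.gen n le_rfl).2 (hI.gen n le_rfl).1 hVf hHf hge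
  obtain ⟨r, er, h3, h4⟩ := slide enc hγ hG n.bodd q n f hI.hH hI.gen hVf hgf
  have hgene : Gen enc a e :=
    gen_V enc (gen_x enc (hI.gen n le_rfl).1 hx hR) ⟨y, hy, hR2⟩
  have hb : (n + 1).bodd = !n.bodd := Nat.bodd_succ n
  have hgood : ∀ m ≤ n + 1, Good enc (if m = n + 1 then e else r m) (m.bodd, (n + 1).bodd) := by
    intro m hm
    by_cases hmn : m = n + 1
    · subst hmn; simpa [hb] using hge
    · simpa [hmn, hb] using (h3 m (by omega)).2
  have hgen : ∀ m ≤ n + 1, Gen enc a (if m = n + 1 then e else r m) := by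
    intro m hm
    by_cases hmn : m = n + 1
    · subst hmn; simpa using hgene
    · simpa [hmn] using gen_V enc (hI.gen m (by omega)).1 (h3 m (by omega)).1
  refine ⟨fun m => if m = n + 1 then e else r m, ⟨?_, ?_, ?_, ?_⟩, ?_⟩
  · intro m hm
    by_cases hmn : m = n
    · subst hmn; simpa [er] using hHf
    · simpa [hmn, show m ≠ n + 1 by omega] using h4 m (by omega)
  · intro m hm
    exact ⟨hgen m hm, good_G enc hγ hG (hgen m hm) (hgood m hm)⟩
  · intro _
    exact hgood
  · refine ⟨x2, d2, by simpa using hR3, hx2, ?_⟩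
    rw [hb]
    exact hd2
  · intro m hm
    simpa [show m ≠ n + 1 by omega] using (h3 m hm).1

lemma octant {W : Finset Tile} (hnd : ¬ TWJ (psiW enc W)) (k : ℕ) : Tiles W (Octant k) := by
  obtain ⟨a, ha, hna⟩ := avoid {χ | TWJ (.imp (.and (alphaF enc) (.and (beta1F enc)
    (.and (beta2F enc W) (.and (gammaF enc W) (Gf enc W false false))))) χ)} (princ_th _) _ hnd
  have ha := ha (TWJ.id _)
  have hα := and1 ha
  have hβ1 := and1 (and2 ha)
  have hβ2 := and1 (and2 (and2 ha))
  have hγ := and1 (and2 (and2 (and2 ha)))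
  have hG := and2 (and2 (and2 (and2 ha)))
  obtain ⟨x, c, hR, hx, hc⟩ := not_imp hna
  let K := k + 1
  have base : Inv enc W a 0 (2 * K) (fun _ => a) := by
    obtain ⟨d, h1, h2⟩ := dp_init hR hc (2 * K)
    exact ⟨by simp, fun m hm => by
      obtain rfl : m = 0 := by omega
      exact ⟨.inl rfl, hG⟩, by simp, ⟨x, d, h1, hx, h2⟩⟩
  have step : ∀ (i : ℕ) (q : ℕ → PT), ∃ q', i < K → Inv enc W a i (2 * (K - i)) q →
      Inv enc W a (i + 1) (2 * (K - (i + 1))) q' ∧ ∀ m ≤ i, V enc (q m) (q' m) := by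
    intro i q
    by_cases h : i < K ∧ Inv enc W a i (2 * (K - i)) q
    · obtain ⟨h1, h2⟩ := h
      rw [show 2 * (K - i) = 2 * (K - (i + 1)) + 2 by omega] at h2
      obtain ⟨q', h3⟩ := inv_step enc hγ hG hα hβ1 hβ2 h2
      exact ⟨q', fun _ _ => h3⟩
    · exact ⟨q, fun h1 h2 => absurd ⟨h1, h2⟩ h⟩
  choose nx hnx using step
  let p : ℕ → ℕ → PT := fun n => Nat.rec (fun _ => a) (fun i q => nx i q) n
  have hp : ∀ i ≤ K, Inv enc W a i (2 * (K - i)) (p i) := by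
    intro i
    induction i with
    | zero => intro _; exact base
    | succ i ih => intro hi; exact (hnx i (p i) (by omega) (ih (by omega))).1
  have hv : ∀ i < K, ∀ m ≤ i, V enc (p i m) (p (i + 1) m) := fun i hi =>
    (hnx i (p i) hi (hp i hi.le)).2
  have ht : ∀ m n : ℕ, ∃ t, m ≤ n → n ≤ k → t ∈ W ∧ tAt enc t ∈ (p (n + 1) m).S ∧
      Fml.imp (yAt enc) (.or (mAt enc m.bodd (n + 1).bodd)
        (.and (mAt enc m.bodd (!(n + 1).bodd)) (Ut enc W t))) ∈ (p (n + 1) m).S := by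
    intro m n
    by_cases h : m ≤ n ∧ n ≤ k
    · have hI := hp (n + 1) (by omega)
      obtain ⟨t, h1, h2, h3⟩ := tile_exists enc hγ hG (hI.gen m (by omega)).1
        (hI.good (by omega) m (by omega))
      exact ⟨t, fun _ _ => ⟨h1, h2, h3⟩⟩
    · exact ⟨default, fun h1 h2 => absurd ⟨h1, h2⟩ h⟩
  choose τ hτ using ht
  refine ⟨fun s => τ s.1.toNat s.2.toNat, ?_, ?_, ?_⟩
  · rintro ⟨m, n⟩ ⟨h1, h2, h3⟩
    simp only at h1 h2 h3
    exact (hτ _ _ (by simp; omega) (by simp; omega)).1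
  · rintro m n ⟨h1, h2, h3⟩ ⟨h4, h5, h6⟩
    simp only at h1 h2 h3 h4 h5 h6
    lift m to ℕ using h1
    lift n to ℕ using (by omega)
    have e1 : ((m : ℤ) + 1).toNat = m + 1 := by omega
    simp only [e1, Int.toNat_natCast]
    have hI := hp (n + 1) (by omega)
    have t1 := hτ m n (by omega) (by omega)
    have t2 := hτ (m + 1) n (by omega) (by omega)
    refine right_match enc (and1 (hI.gen m (by omega)).2) ?_ (hI.hH m (by omega))
      (hI.hH (m + 1) (by omega)) (hI.good (by omega) (m + 1 + 1) (by omega))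
      t1.1 t2.1 t1.2.1 t2.2.1
    rw [← Nat.bodd_succ m]
    exact hI.good (by omega) (m + 1) (by omega)
  · rintro m n ⟨h1, h2, h3⟩ ⟨h4, h5, h6⟩
    simp only at h1 h2 h3 h4 h5 h6
    lift m to ℕ using h1
    lift n to ℕ using (by omega)
    have e1 : ((n : ℤ) + 1).toNat = n + 1 := by omega
    simp only [e1, Int.toNat_natCast]
    have hI := hp (n + 1 + 1) (by omega)
    have t1 := hτ m n (by omega) (by omega)
    have t2 := hτ m (n + 1) (by omega) (by omega)
    refine up_match enc ?_ (hv (n + 1) (by omega) m (by omega))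
      (hI.hH m (by omega)) (hI.good (by omega) (m + 1) (by omega))
      t2.1 t1.2.2 t2.2.1
    rw [← Nat.bodd_succ (n + 1)]
    exact hI.good (by omega) m (by omega)

lemma plane {W : Finset Tile} (h : ∀ k, Tiles W (Octant k)) : Tiles W Set.univ := by
  have sq : ∀ n : ℕ, ∃ τ : ℤ × ℤ → Tile, ∀ u v : ℤ, |u| < n → |v| < n →
      τ (u, v) ∈ W ∧ (|u + 1| < n → tE (τ (u, v)) = tW (τ (u + 1, v))) ∧
        (|v + 1| < n → tN (τ (u, v)) = tS (τ (u, v + 1))) := by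
    intro n
    obtain ⟨τ, h1, h2, h3⟩ := h (4 * n)
    refine ⟨fun s => τ (s.1 + n, s.2 + 3 * n), ?_⟩
    intro u v hu hv
    rw [abs_lt] at hu hv
    have hin : ∀ u v : ℤ, -(n : ℤ) < u → u < n → -(n : ℤ) < v → v < n →
        (u + n, v + 3 * n) ∈ Octant (4 * n) := by
      intro u v _ _ _ _
      refine ⟨?_, ?_, ?_⟩ <;> simp <;> omega
    have h0 := hin u v hu.1 hu.2 hv.1 hv.2
    refine ⟨h1 _ h0, fun hu' => ?_, fun hv' => ?_⟩
    · rw [abs_lt] at hu'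
      have e : u + 1 + (n : ℤ) = u + n + 1 := by ring
      have h4 := hin (u + 1) v hu'.1 hu'.2 hv.1 hv.2
      simp only [e] at h4 ⊢
      exact h2 _ _ h0 h4
    · rw [abs_lt] at hv'
      have e : v + 1 + 3 * (n : ℤ) = v + 3 * n + 1 := by ring
      have h4 := hin u (v + 1) hu.1 hu.2 hv'.1 hv'.2
      simp only [e] at h4 ⊢
      exact h3 _ _ h0 h4
  choose τ hτ using sq
  let F : Ultrafilter ℕ := Filter.hyperfilter ℕ
  have big : ∀ z : ℤ, ∀ᶠ n : ℕ in (F : Filter ℕ), |z| < n := by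
    intro z
    have : ∀ᶠ n : ℕ in Filter.atTop, |z| < n := by
      filter_upwards [Filter.eventually_gt_atTop z.natAbs] with n hn
      rw [abs_lt]
      omega
    exact Nat.hyperfilter_le_atTop this
  have lim : ∀ s : ℤ × ℤ, ∃ t ∈ W, ∀ᶠ n in (F : Filter ℕ), τ n s = t := by
    rintro ⟨u, v⟩
    have : ∀ᶠ n in (F : Filter ℕ), ∃ t ∈ (W : Set Tile), τ n (u, v) = t := by
      filter_upwards [big u, big v] with n h1 h2
      exact ⟨_, (hτ n u v h1 h2).1, rfl⟩
    exact (Ultrafilter.eventually_exists_mem_iff W.finite_toSet).1 this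
  choose σ hσW hσ using lim
  refine ⟨σ, fun s _ => hσW s, ?_, ?_⟩
  · intro m n _ _
    obtain ⟨k, h1, h2, h3, h4, h5⟩ := ((hσ (m, n)).and ((hσ (m + 1, n)).and
      ((big m).and ((big n).and (big (m + 1)))))).exists
    rw [← h1, ← h2]
    exact (hτ k m n h3 h4).2.1 h5
  · intro m n _ _
    obtain ⟨k, h1, h2, h3, h4, h5⟩ := ((hσ (m, n)).and ((hσ (m, n + 1)).and
      ((big m).and ((big n).and (big (n + 1)))))).exists
    rw [← h1, ← h2]
    exact (hτ k m n h3 h4).2.2 h5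

end TWJP

/-- the first tiling lemma: if the tiling formula `ψ_W` is not derivable
in TWJ⁺, then `W` tiles every octant `𝕆(k)`, and hence `W` tiles `ℤ²`. -/
theorem TWJ_refutation_gives_tilings (W : Finset Tile) (enc : Letter → ℕ)
    (henc : Function.Injective enc) (hnd : ¬ TWJ (psiW enc W)) :
    (∀ k : ℕ, Tiles W (Octant k)) ∧ Tiles W Set.univ := by
  exact ⟨TWJP.octant enc hnd, TWJP.plane (TWJP.octant enc hnd)⟩
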